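/- arXiv:0710.5659 — 5 statements merged into one kernel-verified Lean document; each statement's English description precedes it below -/
import Mathlib

section
/- Let C' ⊆ C be nonempty. If u ∼_{C'} v and Reach_{Σ^l ∪ C'}(u,w) holds in the synchronized product G, then there exists a vertex w' of G such that Reach_{Σ^l ∪ C'}(v,w') holds in G and w ∼_{C'} w'. -/
/- Synchronized products of labeled transition systems.
   Component `i` has vertex type `V i`, local labels `Locl i`, synchronizing
   labels `Syncl i` (distinct types across components model disjointness),
   and edge relations `Eloc i a`, `Esync i a`.  A synchronization constraint
   is a set of tuples `c : ∀ i, Option (Syncl i)` where `none` plays the role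
   of ε. -/

namespace SyncProd

variable {n : ℕ} {V : Fin n → Type*} {Locl : Fin n → Type*} {Syncl : Fin n → Type*}

/-- Effect of an optional synchronizing label in one component
    (`none` = ε means the component does not move). -/
def OptStep {α β : Type*} (E : β → α → α → Prop) : Option β → α → α → Prop
  | some a => E a
  | none => Eq

/-- A local `a`-labeled edge of the product, acting in component `i`:
    `E_a^G(u,v)` iff `E_a^i(u_i,v_i)` and `u_j = v_j` for `j ≠ i`. -/
def LocEdge (Eloc : ∀ i, Locl i → V i → V i → Prop) (i : Fin n) (a : Locl i)
    (u v : ∀ j, V j) : Prop :=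
  Eloc i a (u i) (v i) ∧ ∀ j, j ≠ i → u j = v j

/-- A synchronized edge of the product labeled by the constraint tuple `c`:
    componentwise `E_{c_i}^i` where `c_i ≠ ε`, and equality where `c_i = ε`. -/
def SyncEdge (Esync : ∀ i, Syncl i → V i → V i → Prop)
    (c : ∀ i, Option (Syncl i)) (u v : ∀ j, V j) : Prop :=
  ∀ i, OptStep (Esync i) (c i) (u i) (v i)

/-- One step of the product with a label in `Σ^l ∪ C'`:
    either some local edge, or a synchronized edge with tuple in `C'`. -/
def Step (Eloc : ∀ i, Locl i → V i → V i → Prop)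
    (Esync : ∀ i, Syncl i → V i → V i → Prop)
    (C' : Set (∀ i, Option (Syncl i))) (u v : ∀ j, V j) : Prop :=
  (∃ i, ∃ a, LocEdge Eloc i a u v) ∨ ∃ c ∈ C', SyncEdge Esync c u v

/-- `u ∼_{C'} v` : `u` and `v` agree on every component in
    `X_{C'} = ⋃_{c ∈ C'} {i | c_i ≠ ε}`. -/
def SimC (C' : Set (∀ i, Option (Syncl i))) (u v : ∀ j, V j) : Prop :=
  ∀ i, (∃ c ∈ C', c i ≠ none) → u i = v i

/-- `V_{C'}` : the vertices of the product from which an outgoing `c`-labeled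
    synchronized transition exists for every `c ∈ C'`. -/
def VC (Esync : ∀ i, Syncl i → V i → V i → Prop)
    (C' : Set (∀ i, Option (Syncl i))) : Set (∀ j, V j) :=
  {u | ∀ c ∈ C', ∃ w, SyncEdge Esync c u w}

/-- The set of equivalence classes of `∼_{C'}` restricted to `V_{C'}`. -/
def Classes (Esync : ∀ i, Syncl i → V i → V i → Prop)
    (C' : Set (∀ i, Option (Syncl i))) : Set (Set (∀ j, V j)) :=
  {s | ∃ u ∈ VC Esync C', s = {v | v ∈ VC Esync C' ∧ SimC C' u v}}

/-- Reachability inside component `i` using only its local edges. -/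
def ReachLoc (Eloc : ∀ i, Locl i → V i → V i → Prop) (i : Fin n) : V i → V i → Prop :=
  Relation.ReflTransGen (fun p q => ∃ a, Eloc i a p q)

end SyncProd

open SyncProd Relation

/-- Lemma 1(b): for nonempty `C' ⊆ C`, if `u ∼_{C'} v` and
`Reach_{Σ^l ∪ C'}(u,w)` holds in the synchronized product, then there is a
vertex `w'` with `Reach_{Σ^l ∪ C'}(v,w')` and `w ∼_{C'} w'`. -/
theorem reach_respects_simC
    {n : ℕ} (hn : 1 ≤ n)
    {V Locl Syncl : Fin n → Type*}
    [∀ i, Fintype (Locl i)] [∀ i, Fintype (Syncl i)]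
    (Eloc : ∀ i, Locl i → V i → V i → Prop)
    (Esync : ∀ i, Syncl i → V i → V i → Prop)
    (C C' : Set (∀ i, Option (Syncl i)))
    (hsub : C' ⊆ C) (hne : C'.Nonempty)
    (u v w : ∀ i, V i)
    (hsim : SimC C' u v)
    (hreach : Relation.ReflTransGen (Step Eloc Esync C') u w) :
    ∃ w' : ∀ i, V i,
      Relation.ReflTransGen (Step Eloc Esync C') v w' ∧ SimC C' w w' := by
  classical
  induction hreach with
  | refl => exact ⟨v, .refl, hsim⟩
  | @tail y z _ hstep ih =>
    obtain ⟨x, hx, hyx⟩ := ih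
    rcases hstep with ⟨i, a, ha, hrest⟩ | ⟨c, hc, hs⟩
    · by_cases hi : ∃ c ∈ C', c i ≠ none
      · refine ⟨Function.update x i (z i), hx.tail (Or.inl ⟨i, a, ?_, ?_⟩), ?_⟩
        · rw [Function.update_self, ← hyx i hi]
          exact ha
        · intro j hj
          rw [Function.update_of_ne hj]
        · intro j hj
          by_cases hji : j = i
          · subst hji
            rw [Function.update_self]
          · rw [Function.update_of_ne hji, ← hrest j hji]
            exact hyx j hj
      · refine ⟨x, hx, fun j hj => ?_⟩
        have hji : j ≠ i := by
          rintro rfl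
          exact hi hj
        rw [← hrest j hji]
        exact hyx j hj
    · refine ⟨fun j => if ∃ c ∈ C', c j ≠ none then z j else x j,
        hx.tail (Or.inr ⟨c, hc, fun j => ?_⟩), fun j hj => (if_pos hj).symm⟩
      by_cases hj : ∃ c ∈ C', c j ≠ none
      · simp only [if_pos hj]
        rw [← hyx j hj]
        exact hs j
      · simp only [if_neg hj]
        have hcj : c j = none := by
          by_contra h
          exact hj ⟨c, hc, h⟩
        rw [hcj]
        exact rfl
end

section
/- Paths in a synchronized product can be reordered so that local steps in non-synchronizing components come first: let C' ⊆ C be nonempty. If Reach_{Σ^l ∪ C'}(u,w) holds in G, then there exists a vertex u' such that Reach_{Γ_out}(u,u') and Reach_{Γ_in}(u',w) hold in G, where Γ_out = ⋃_{i ∉ X_{C'}} Σ_i^l and Γ_in = (⋃_{i ∈ X_{C'}} Σ_i^l) ∪ C'. -/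
open SyncProd Relation

/-- paths in a synchronized product can be reordered so that local
steps in components outside `X_{C'}` come first: if `Reach_{Σ^l ∪ C'}(u,w)`,
then there is `u'` with `Reach_{Γ_out}(u,u')` and `Reach_{Γ_in}(u',w)`, where
`Γ_out = ⋃_{i ∉ X_{C'}} Σ_i^l` and `Γ_in = (⋃_{i ∈ X_{C'}} Σ_i^l) ∪ C'`. -/
theorem reach_reorder_local_steps
    {n : ℕ} (hn : 1 ≤ n)
    {V Locl Syncl : Fin n → Type*}
    [∀ i, Fintype (Locl i)] [∀ i, Fintype (Syncl i)]
    (Eloc : ∀ i, Locl i → V i → V i → Prop)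
    (Esync : ∀ i, Syncl i → V i → V i → Prop)
    (C C' : Set (∀ i, Option (Syncl i)))
    (hsub : C' ⊆ C) (hne : C'.Nonempty)
    (u w : ∀ i, V i)
    (hreach : Relation.ReflTransGen (Step Eloc Esync C') u w) :
    ∃ u' : ∀ i, V i,
      Relation.ReflTransGen
        (fun p q => ∃ i, (¬ ∃ c ∈ C', c i ≠ none) ∧ ∃ a, LocEdge Eloc i a p q) u u' ∧
      Relation.ReflTransGen
        (fun p q => (∃ i, (∃ c ∈ C', c i ≠ none) ∧ ∃ a, LocEdge Eloc i a p q) ∨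
          ∃ c ∈ C', SyncEdge Esync c p q) u' w := by
  classical
  have swap : ∀ p q r : ∀ i, V i,
      ((∃ i, (∃ c ∈ C', c i ≠ none) ∧ ∃ a, LocEdge Eloc i a p q) ∨
          ∃ c ∈ C', SyncEdge Esync c p q) →
      (∃ i, (¬ ∃ c ∈ C', c i ≠ none) ∧ ∃ a, LocEdge Eloc i a q r) →
      ∃ x : ∀ i, V i,
        (∃ i, (¬ ∃ c ∈ C', c i ≠ none) ∧ ∃ a, LocEdge Eloc i a p x) ∧
        ((∃ i, (∃ c ∈ C', c i ≠ none) ∧ ∃ a, LocEdge Eloc i a x r) ∨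
          ∃ c ∈ C', SyncEdge Esync c x r) := by
    rintro p q r hin ⟨i, hi, a, ha, hqr⟩
    have hpq : p i = q i := by
      rcases hin with ⟨j, hj, b, -, hb⟩ | ⟨c, hc, h⟩
      · exact hb i (fun e => hi (e ▸ hj))
      · have hci : c i = none := by
          by_contra hne'
          exact hi ⟨c, hc, hne'⟩
        have := h i
        rw [hci] at this
        exact this
    refine ⟨Function.update p i (r i), ⟨i, hi, a, ?_, ?_⟩, ?_⟩
    · rw [Function.update_self, hpq]
      exact ha
    · intro j hj
      rw [Function.update_of_ne hj]
    · rcases hin with ⟨j, hj, b, hb, hb'⟩ | ⟨c, hc, h⟩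
      · have hji : j ≠ i := fun e => hi (e ▸ hj)
        refine Or.inl ⟨j, hj, b, ?_, ?_⟩
        · rw [Function.update_of_ne hji, ← hqr j hji]
          exact hb
        · intro k hk
          by_cases hki : k = i
          · subst hki
            rw [Function.update_self]
          · rw [Function.update_of_ne hki, ← hqr k hki]
            exact hb' k hk
      · refine Or.inr ⟨c, hc, fun k => ?_⟩
        by_cases hki : k = i
        · subst hki
          have hck : c k = none := by
            by_contra hne'
            exact hi ⟨c, hc, hne'⟩
          rw [Function.update_self, hck]
          exact rfl
        · rw [Function.update_of_ne hki, ← hqr k hki]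
          exact h k
  have swaps : ∀ p q r : ∀ i, V i,
      ((∃ i, (∃ c ∈ C', c i ≠ none) ∧ ∃ a, LocEdge Eloc i a p q) ∨
          ∃ c ∈ C', SyncEdge Esync c p q) →
      Relation.ReflTransGen
        (fun p q => ∃ i, (¬ ∃ c ∈ C', c i ≠ none) ∧ ∃ a, LocEdge Eloc i a p q) q r →
      ∃ x : ∀ i, V i,
        Relation.ReflTransGen
          (fun p q => ∃ i, (¬ ∃ c ∈ C', c i ≠ none) ∧ ∃ a, LocEdge Eloc i a p q) p x ∧
        ((∃ i, (∃ c ∈ C', c i ≠ none) ∧ ∃ a, LocEdge Eloc i a x r) ∨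
          ∃ c ∈ C', SyncEdge Esync c x r) := by
    intro p q r hin hout
    induction hout with
    | refl => exact ⟨p, Relation.ReflTransGen.refl, hin⟩
    | tail _ hstep ih =>
      obtain ⟨x, hx, hx'⟩ := ih
      obtain ⟨y, hy, hy'⟩ := swap _ _ _ hx' hstep
      exact ⟨y, hx.tail hy, hy'⟩
  induction hreach using Relation.ReflTransGen.head_induction_on with
  | refl => exact ⟨w, Relation.ReflTransGen.refl, Relation.ReflTransGen.refl⟩
  | head hstep _ ih =>
    obtain ⟨v', h1, h2⟩ := ih
    have key : ∀ p q : ∀ i, V i, Step Eloc Esync C' p q →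
        (∃ i, (¬ ∃ c ∈ C', c i ≠ none) ∧ ∃ a, LocEdge Eloc i a p q) ∨
        ((∃ i, (∃ c ∈ C', c i ≠ none) ∧ ∃ a, LocEdge Eloc i a p q) ∨
          ∃ c ∈ C', SyncEdge Esync c p q) := by
      rintro p q (⟨i, a, h⟩ | h)
      · by_cases hi : ∃ c ∈ C', c i ≠ none
        · exact Or.inr (Or.inl ⟨i, hi, a, h⟩)
        · exact Or.inl ⟨i, hi, a, h⟩
      · exact Or.inr (Or.inr h)
    rcases key _ _ hstep with h | h
    · exact ⟨v', h1.head h, h2⟩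
    · obtain ⟨x, hx, hx'⟩ := swaps _ _ _ h h1
      exact ⟨x, hx, h2.head hx'⟩
end

section
/- Reachability in a synchronized product decomposes componentwise along a common word of synchronizing transitions: for C' ⊆ C and vertices u, v of G, Reach_{Σ^l ∪ C'}(u,v) holds in G if and only if there exist m ≥ 0 and c^(1),…,c^(m) ∈ C' such that for every component i there are vertices y_0^i, x_1^i, y_1^i, …, x_m^i, y_m^i ∈ V_i with: Reach_{Σ_i^l}(u_i, y_0^i) in G_i; for each 1 ≤ j ≤ m, E^i_{c^(j)_i}(y_{j-1}^i, x_j^i) if c^(j)_i ≠ ε and x_j^i = y_{j-1}^i if c^(j)_i = ε, and Reach_{Σ_i^l}(x_j^i, y_j^i) in G_i; and y_m^i = v_i. -/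
open SyncProd Relation

theorem SyncProd.aux_single {n : ℕ} {V Locl Syncl : Fin n → Type*}
    (Eloc : ∀ i, Locl i → V i → V i → Prop)
    (Esync : ∀ i, Syncl i → V i → V i → Prop)
    (C' : Set (∀ i, Option (Syncl i))) (w : ∀ i, V i) (i : Fin n) (p q : V i)
    (h : ReachLoc Eloc i p q) :
    Relation.ReflTransGen (Step Eloc Esync C') (Function.update w i p)
      (Function.update w i q) := by
  refine Relation.ReflTransGen.lift (fun p => Function.update w i p) ?_ _ _ h
  rintro a b ⟨l, hl⟩
  refine Or.inl ⟨i, l, ?_, ?_⟩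
  · simpa using hl
  · intro j hj
    simp [Function.update_of_ne hj]

theorem SyncProd.aux_local {n : ℕ} {V Locl Syncl : Fin n → Type*}
    (Eloc : ∀ i, Locl i → V i → V i → Prop)
    (Esync : ∀ i, Syncl i → V i → V i → Prop)
    (C' : Set (∀ i, Option (Syncl i))) (u v : ∀ i, V i)
    (h : ∀ i, ReachLoc Eloc i (u i) (v i)) :
    Relation.ReflTransGen (Step Eloc Esync C') u v := by
  have key : ∀ s : Finset (Fin n), Relation.ReflTransGen (Step Eloc Esync C') u
      (fun i => if i ∈ s then v i else u i) := by
    intro s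
    induction s using Finset.induction_on with
    | empty => simpa using Relation.ReflTransGen.refl
    | insert a s ha ih =>
      refine ih.trans ?_
      have := SyncProd.aux_single Eloc Esync C' (fun i => if i ∈ s then v i else u i) a _ _ (h a)
      convert this using 1
      · funext j
        by_cases hj : j = a
        · subst hj; simp [ha]
        · simp [Function.update_of_ne hj]
      · funext j
        by_cases hj : j = a
        · subst hj; simp
        · simp [Function.update_of_ne hj, hj]
  simpa using key Finset.univ

/-- reachability in a synchronized product decomposes
componentwise along a common word `c^(1), …, c^(m) ∈ C'` of synchronizing
transitions: `Reach_{Σ^l ∪ C'}(u,v)` iff there are `m ≥ 0` and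
`c^(1),…,c^(m) ∈ C'` such that in every component `i` there are vertices
`y_0, x_1, y_1, …, x_m, y_m` with `Reach_{Σ_i^l}(u_i, y_0)`, componentwise
sync moves `y_{j-1} → x_j` (equality when `c^(j)_i = ε`), local reachability
`Reach_{Σ_i^l}(x_j, y_j)`, and `y_m = v_i`. -/
theorem reach_decomposition
    {n : ℕ} (hn : 1 ≤ n)
    {V Locl Syncl : Fin n → Type*}
    [∀ i, Fintype (Locl i)] [∀ i, Fintype (Syncl i)]
    (Eloc : ∀ i, Locl i → V i → V i → Prop)
    (Esync : ∀ i, Syncl i → V i → V i → Prop)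
    (C C' : Set (∀ i, Option (Syncl i)))
    (hsub : C' ⊆ C)
    (u v : ∀ i, V i) :
    Relation.ReflTransGen (Step Eloc Esync C') u v ↔
      ∃ (m : ℕ) (cs : Fin m → ∀ i, Option (Syncl i)),
        (∀ j, cs j ∈ C') ∧
        ∀ i, ∃ (y : Fin (m + 1) → V i) (x : Fin m → V i),
          ReachLoc Eloc i (u i) (y 0) ∧
          y (Fin.last m) = v i ∧
          ∀ j : Fin m,
            OptStep (Esync i) (cs j i) (y j.castSucc) (x j) ∧
            ReachLoc Eloc i (x j) (y j.succ) := by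
  constructor
  · intro h
    induction h using Relation.ReflTransGen.head_induction_on with
    | refl =>
      exact ⟨0, Fin.elim0, fun j => j.elim0, fun i => ⟨fun _ => v i, Fin.elim0,
        Relation.ReflTransGen.refl, rfl, fun j => j.elim0⟩⟩
    | head hs htail ih =>
      rename_i a b
      obtain ⟨m, cs, hcs, H⟩ := ih
      rcases hs with ⟨i₀, l, hl, hne⟩ | ⟨c, hc, hs⟩
      · refine ⟨m, cs, hcs, fun i => ?_⟩
        obtain ⟨y, x, h0, hr⟩ := H i
        refine ⟨y, x, ?_, hr⟩
        by_cases hi : i = i₀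
        · subst hi
          exact Relation.ReflTransGen.head ⟨l, hl⟩ h0
        · rw [hne i hi]
          exact h0
      · refine ⟨m + 1, Fin.cons (α := fun _ => ∀ i, Option (Syncl i)) c cs, ?_, fun i => ?_⟩
        · intro j
          refine Fin.cases ?_ (fun j => ?_) j
          · simpa using hc
          · simpa using hcs j
        · obtain ⟨y, x, h0, hl, hr⟩ := H i
          refine ⟨Fin.cons (α := fun _ => V i) (a i) y, Fin.cons (α := fun _ => V i) (b i) x,
            Relation.ReflTransGen.refl, ?_, ?_⟩
          · rw [← Fin.succ_last, Fin.cons_succ]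
            exact hl
          · intro j
            refine Fin.cases ?_ (fun j => ?_) j
            · exact ⟨hs i, h0⟩
            · exact hr j
  · rintro ⟨m, cs, hcs, H⟩
    choose y x h0 hl hr using H
    have key : ∀ j : Fin (m + 1), Relation.ReflTransGen (Step Eloc Esync C') u
        (fun i => y i j) := by
      intro j
      induction j using Fin.induction with
      | zero => exact SyncProd.aux_local Eloc Esync C' _ _ h0
      | succ j ih =>
        refine (ih.tail (c := fun i => x i j)
          (Or.inr ⟨cs j, hcs j, fun i => (hr i j).1⟩)).trans ?_
        exact SyncProd.aux_local Eloc Esync C' _ _ (fun i => (hr i j).2)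
    have e : (fun i => y i (Fin.last m)) = v := funext hl
    exact e ▸ key (Fin.last m)
end

section
/- Consecutive squares via transitive closure: let P be the binary relation on ℕ × ℕ given by P((x₁,x₂),(y₁,y₂)) iff y₁ = x₂ and y₂ + x₁ = 2·x₂ + 2 (i.e., y₂ = x₂ + (x₂ − x₁) + 2). Then for all a, b ∈ ℕ, the transitive closure of P (at least one step) relates (0,1) to (a,b) if and only if there exists k ≥ 1 with a = k² and b = (k+1)². -/
/-- consecutive squares via transitive closure: for the step
relation `P((x₁,x₂),(y₁,y₂)) :↔ y₁ = x₂ ∧ y₂ + x₁ = 2·x₂ + 2` on `ℕ × ℕ`, the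
transitive closure of `P` (at least one step) relates `(0,1)` to `(a,b)` iff
`a = k²` and `b = (k+1)²` for some `k ≥ 1`. -/
theorem transGen_consecutive_squares (a b : ℕ) :
    Relation.TransGen
        (fun p q : ℕ × ℕ => q.1 = p.2 ∧ q.2 + p.1 = 2 * p.2 + 2) (0, 1) (a, b) ↔
      ∃ k : ℕ, 1 ≤ k ∧ a = k ^ 2 ∧ b = (k + 1) ^ 2 := by
  constructor
  · intro h
    have key : ∀ q : ℕ × ℕ, Relation.TransGen
        (fun p q : ℕ × ℕ => q.1 = p.2 ∧ q.2 + p.1 = 2 * p.2 + 2) (0, 1) q →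
        ∃ k : ℕ, 1 ≤ k ∧ q.1 = k ^ 2 ∧ q.2 = (k + 1) ^ 2 := by
      intro q hq
      induction hq with
      | single h =>
        obtain ⟨h1, h2⟩ := h
        refine ⟨1, le_refl 1, ?_, ?_⟩
        · simpa using h1
        · simpa using h2
      | tail _ h ih =>
        obtain ⟨k, hk, e1, e2⟩ := ih
        obtain ⟨h1, h2⟩ := h
        refine ⟨k + 1, by omega, by rw [h1, e2], ?_⟩
        rw [e1, e2] at h2
        nlinarith
    exact key (a, b) h
  · rintro ⟨k, hk, rfl, rfl⟩
    induction k, hk using Nat.le_induction with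
    | base => exact Relation.TransGen.single ⟨by norm_num, by norm_num⟩
    | succ k hk ih => exact ih.tail ⟨rfl, by ring⟩
end

section
/- The square function is definable from the consecutive-squares relation: let P be the binary relation on ℕ × ℕ given by P((x₁,x₂),(y₁,y₂)) iff y₁ = x₂ and y₂ + x₁ = 2·x₂ + 2. Then for all a, b ∈ ℕ with a ≥ 2, one has b = a² if and only if there exists z ∈ ℕ such that the transitive closure of P (at least one step) relates (0,1) to (z,b) and b + 1 = z + 2·a. -/
theorem consec_forward (k : ℕ) :
    Relation.TransGen
      (fun p q : ℕ × ℕ => q.1 = p.2 ∧ q.2 + p.1 = 2 * p.2 + 2) (0, 1)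
      ((k + 1) ^ 2, (k + 2) ^ 2) := by
  induction k with
  | zero => exact Relation.TransGen.single (by norm_num)
  | succ k ih =>
    refine Relation.TransGen.tail ih ⟨rfl, ?_⟩
    simp only
    ring

theorem consec_backward (q : ℕ × ℕ)
    (h : Relation.TransGen
      (fun p q : ℕ × ℕ => q.1 = p.2 ∧ q.2 + p.1 = 2 * p.2 + 2) (0, 1) q) :
    ∃ k : ℕ, q.1 = k ^ 2 ∧ q.2 = (k + 1) ^ 2 := by
  induction h with
  | single h => exact ⟨1, by simpa using h.1, by have := h.2; simp at this; omega⟩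
  | tail _ h ih =>
    obtain ⟨k, h1, h2⟩ := ih
    obtain ⟨h3, h4⟩ := h
    refine ⟨k + 1, h3.trans h2, ?_⟩
    rw [h1, h2] at h4
    nlinarith

/-- the square function is definable from the
consecutive-squares relation: with `P((x₁,x₂),(y₁,y₂)) :↔ y₁ = x₂ ∧
y₂ + x₁ = 2·x₂ + 2`, for all `a ≥ 2` and `b` one has `b = a²` iff there is `z`
such that the transitive closure of `P` relates `(0,1)` to `(z,b)` and
`b + 1 = z + 2·a`. -/
theorem square_definable_from_consecutive_squares (a b : ℕ) (ha : 2 ≤ a) :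
    b = a ^ 2 ↔
      ∃ z : ℕ,
        Relation.TransGen
          (fun p q : ℕ × ℕ => q.1 = p.2 ∧ q.2 + p.1 = 2 * p.2 + 2) (0, 1) (z, b) ∧
        b + 1 = z + 2 * a := by
  constructor
  · rintro rfl
    obtain ⟨k, rfl⟩ := Nat.exists_eq_add_of_le ha
    refine ⟨(k + 1) ^ 2, ?_, by ring⟩
    rw [add_comm 2 k]
    exact consec_forward k
  · rintro ⟨z, h, hb⟩
    obtain ⟨k, h1, h2⟩ := consec_backward _ h
    simp only at h1 h2
    have : a = k + 1 := by
      rw [h1, h2] at hb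
      nlinarith
    rw [h2, this]
end
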